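/- For any two polygonal curves P and Q in ℝ^d, d_VE(P,Q) ≤ d_F(P,Q); that is, the VE Fréchet distance is a lower bound on the (monotone, continuous) Fréchet distance. -/

import Mathlib

open Set

/-- The vertices of a polygonal curve, extended to an `ℕ`-indexed family by clamping. -/
def pext {d n : ℕ} (p : Fin (n + 1) → EuclideanSpace ℝ (Fin d)) :
    ℕ → EuclideanSpace ℝ (Fin d) :=
  fun j => p ⟨min j n, Nat.lt_succ_of_le (min_le_right _ _)⟩

/-- `cum p i` is the arc length of the polygonal curve `p` up to its `i`-th vertex;
`cum p n` is its total length. -/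
noncomputable def cum {d n : ℕ} (p : Fin (n + 1) → EuclideanSpace ℝ (Fin d)) (i : ℕ) : ℝ :=
  ∑ j ∈ Finset.range (min i n), dist (pext p j) (pext p (j + 1))

/-- `A : [0, cum p n] → ℝ^d` is the uniform (arc-length) parameterization of the polygonal
curve with vertices `p 0, …, p n`. -/
def IsArcParam {d n : ℕ} (p : Fin (n + 1) → EuclideanSpace ℝ (Fin d))
    (A : ℝ → EuclideanSpace ℝ (Fin d)) : Prop :=
  ∀ i < n, ∀ x ∈ Set.Icc (cum p i) (cum p (i + 1)),
    A x = pext p i +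
      ((x - cum p i) / dist (pext p i) (pext p (i + 1))) • (pext p (i + 1) - pext p i)

/-- `z` is the portal of the vertical grid edge `{cum p i} × [cum q j, cum q (j+1)]` of the
free space diagram: the unique point minimizing the elevation `(x,y) ↦ dist (A x) (B y)` on
that edge, except that the portals of the grid edges incident to the corners `(0,0)` and
`(cum p n, cum q m)` are placed at those corners. -/
def IsVPortal {d n m : ℕ} (p : Fin (n + 1) → EuclideanSpace ℝ (Fin d))
    (q : Fin (m + 1) → EuclideanSpace ℝ (Fin d))
    (A B : ℝ → EuclideanSpace ℝ (Fin d)) (i j : ℕ) (z : ℝ × ℝ) : Prop :=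
  (i = 0 ∧ j = 0 ∧ z = ((0 : ℝ), (0 : ℝ))) ∨
  (i = n ∧ j = m - 1 ∧ z = (cum p n, cum q m)) ∨
  (¬(i = 0 ∧ j = 0) ∧ ¬(i = n ∧ j = m - 1) ∧
    z.1 = cum p i ∧ z.2 ∈ Set.Icc (cum q j) (cum q (j + 1)) ∧
    ∀ y ∈ Set.Icc (cum q j) (cum q (j + 1)),
      dist (A z.1) (B z.2) ≤ dist (A (cum p i)) (B y))

/-- `z` is the portal of the horizontal grid edge `[cum p i, cum p (i+1)] × {cum q j}`. -/
def IsHPortal {d n m : ℕ} (p : Fin (n + 1) → EuclideanSpace ℝ (Fin d))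
    (q : Fin (m + 1) → EuclideanSpace ℝ (Fin d))
    (A B : ℝ → EuclideanSpace ℝ (Fin d)) (i j : ℕ) (z : ℝ × ℝ) : Prop :=
  (i = 0 ∧ j = 0 ∧ z = ((0 : ℝ), (0 : ℝ))) ∨
  (i = n - 1 ∧ j = m ∧ z = (cum p n, cum q m)) ∨
  (¬(i = 0 ∧ j = 0) ∧ ¬(i = n - 1 ∧ j = m) ∧
    z.2 = cum q j ∧ z.1 ∈ Set.Icc (cum p i) (cum p (i + 1)) ∧
    ∀ x ∈ Set.Icc (cum p i) (cum p (i + 1)),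
      dist (A z.1) (B z.2) ≤ dist (A x) (B (cum q j)))

/-- The directed edges of the VE graph: inside each grid cell `(i,j)`, from the portals of
its left and bottom edges to the portals of its right and top edges. -/
def VEEdge {d n m : ℕ} (p : Fin (n + 1) → EuclideanSpace ℝ (Fin d))
    (q : Fin (m + 1) → EuclideanSpace ℝ (Fin d))
    (A B : ℝ → EuclideanSpace ℝ (Fin d)) (u v : ℝ × ℝ) : Prop :=
  ∃ i < n, ∃ j < m,
    (IsVPortal p q A B i j u ∨ IsHPortal p q A B i j u) ∧
    (IsVPortal p q A B (i + 1) j v ∨ IsHPortal p q A B i (j + 1) v)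

/-- A directed path in the VE graph from `s = (0,0)` to `t = (cum p n, cum q m)`. -/
def IsVEPath {d n m : ℕ} (p : Fin (n + 1) → EuclideanSpace ℝ (Fin d))
    (q : Fin (m + 1) → EuclideanSpace ℝ (Fin d))
    (A B : ℝ → EuclideanSpace ℝ (Fin d)) (l : List (ℝ × ℝ)) : Prop :=
  l.head? = some ((0 : ℝ), (0 : ℝ)) ∧ l.getLast? = some (cum p n, cum q m) ∧
    l.Chain' (VEEdge p q A B)

/-- The width (maximum height/elevation of a vertex) of a path in the free-space diagram. -/
noncomputable def pathWidth {d : ℕ} (A B : ℝ → EuclideanSpace ℝ (Fin d))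
    (l : List (ℝ × ℝ)) : ℝ :=
  sSup ((fun z : ℝ × ℝ => dist (A z.1) (B z.2)) '' { z | z ∈ l })

/-- The VE Fréchet distance: the minimum width of a directed path in the VE graph from
`s` to `t`. -/
noncomputable def dVE {d n m : ℕ} (p : Fin (n + 1) → EuclideanSpace ℝ (Fin d))
    (q : Fin (m + 1) → EuclideanSpace ℝ (Fin d))
    (A B : ℝ → EuclideanSpace ℝ (Fin d)) : ℝ :=
  sInf { r | ∃ l, IsVEPath p q A B l ∧ r = pathWidth A B l }

/-- A weakly monotone continuous reparameterization of `[0,1]` onto `[0,L]`. -/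
def IsReparamTo (L : ℝ) (φ : ℝ → ℝ) : Prop :=
  ContinuousOn φ (Set.Icc 0 1) ∧ MonotoneOn φ (Set.Icc 0 1) ∧
    φ '' Set.Icc 0 1 = Set.Icc 0 L

/-- The (monotone, continuous) Fréchet distance between curves `A : [0,LP] → ℝ^d` and
`B : [0,LQ] → ℝ^d`. -/
noncomputable def frechetDistL {d : ℕ} (LP LQ : ℝ)
    (A B : ℝ → EuclideanSpace ℝ (Fin d)) : ℝ :=
  sInf { r | ∃ φ ψ, IsReparamTo LP φ ∧ IsReparamTo LQ ψ ∧
    r = sSup ((fun t => dist (A (φ t)) (B (ψ t))) '' Set.Icc (0 : ℝ) 1) }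

/-! ### Arc length and arc-length parameterizations -/

lemma cum_zero {d n : ℕ} (p : Fin (n + 1) → EuclideanSpace ℝ (Fin d)) : cum p 0 = 0 := by
  simp [cum]

lemma cum_lt_cum_succ {d n : ℕ} {p : Fin (n + 1) → EuclideanSpace ℝ (Fin d)} {i : ℕ}
    (hi : i < n) (h : pext p i ≠ pext p (i + 1)) : cum p i < cum p (i + 1) := by
  unfold cum
  rw [min_eq_left hi.le, min_eq_left hi, Finset.sum_range_succ]
  linarith [dist_pos.2 h]

lemma monotone_cum {d n : ℕ} (p : Fin (n + 1) → EuclideanSpace ℝ (Fin d)) :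
    Monotone (cum p) := by
  intro i j hij
  refine Finset.sum_le_sum_of_subset_of_nonneg ?_ fun _ _ _ => dist_nonneg
  exact Finset.range_mono (min_le_min_right n hij)

lemma IsArcParam.continuousOn {d n : ℕ} {p : Fin (n + 1) → EuclideanSpace ℝ (Fin d)}
    {A : ℝ → EuclideanSpace ℝ (Fin d)} (hA : IsArcParam p A) {i : ℕ} (hi : i < n) :
    ContinuousOn A (Icc (cum p i) (cum p (i + 1))) := by
  refine ContinuousOn.congr (Continuous.continuousOn ?_) (hA i hi)
  fun_prop

lemma Icc_cum_subset_iUnion {d n : ℕ} (hn : 1 ≤ n) (p : Fin (n + 1) → EuclideanSpace ℝ (Fin d)) :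
    Icc 0 (cum p n) ⊆ ⋃ i ∈ Finset.range n, Icc (cum p i) (cum p (i + 1)) := by
  intro x hx
  have hex : ∃ k, x ≤ cum p (k + 1) := ⟨n - 1, by rw [Nat.sub_add_cancel hn]; exact hx.2⟩
  classical
  have hlt : Nat.find hex < n := by
    have : Nat.find hex ≤ n - 1 :=
      Nat.find_min' hex (by rw [Nat.sub_add_cancel hn]; exact hx.2)
    omega
  simp only [mem_iUnion, Finset.mem_range]
  refine ⟨Nat.find hex, hlt, ?_, Nat.find_spec hex⟩
  rcases hk : Nat.find hex with _ | k
  · rw [cum_zero]; exact hx.1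
  · exact (not_le.1 (Nat.find_min hex (m := k) (by omega))).le

lemma IsArcParam.isBounded_image {d n : ℕ} (hn : 1 ≤ n)
    {p : Fin (n + 1) → EuclideanSpace ℝ (Fin d)}
    {A : ℝ → EuclideanSpace ℝ (Fin d)} (hA : IsArcParam p A) :
    Bornology.IsBounded (A '' Icc 0 (cum p n)) := by
  refine Bornology.IsBounded.subset ?_ (image_mono (Icc_cum_subset_iUnion hn p))
  simp only [image_iUnion]
  rw [Bornology.isBounded_biUnion_finset]
  intro i hi
  exact (isCompact_Icc.image_of_continuousOn (hA.continuousOn (Finset.mem_range.1 hi))).isBounded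

/-! ### Reparameterizations -/

lemma isReparamTo_mul {L : ℝ} (hL : 0 ≤ L) : IsReparamTo L (fun t => L * t) := by
  refine ⟨by fun_prop, fun a _ b _ h => mul_le_mul_of_nonneg_left h hL, ?_⟩
  rw [image_mul_left_Icc hL zero_le_one]
  simp

lemma IsReparamTo.map_zero {L : ℝ} {φ : ℝ → ℝ} (hL : 0 ≤ L) (h : IsReparamTo L φ) :
    φ 0 = 0 := by
  obtain ⟨_, hm, him⟩ := h
  have h0 : (0 : ℝ) ∈ Icc (0 : ℝ) 1 := ⟨le_rfl, zero_le_one⟩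
  obtain ⟨t, ht, hφ⟩ : (0 : ℝ) ∈ φ '' Icc 0 1 := him ▸ ⟨le_rfl, hL⟩
  have h1 : φ 0 ∈ Icc 0 L := him ▸ mem_image_of_mem φ h0
  exact le_antisymm (hφ ▸ hm h0 ht ht.1) h1.1

lemma IsReparamTo.map_one {L : ℝ} {φ : ℝ → ℝ} (hL : 0 ≤ L) (h : IsReparamTo L φ) :
    φ 1 = L := by
  obtain ⟨_, hm, him⟩ := h
  have h0 : (1 : ℝ) ∈ Icc (0 : ℝ) 1 := ⟨zero_le_one, le_rfl⟩
  obtain ⟨t, ht, hφ⟩ : L ∈ φ '' Icc 0 1 := him ▸ ⟨hL, le_rfl⟩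
  have h1 : φ 1 ∈ Icc 0 L := him ▸ mem_image_of_mem φ h0
  exact le_antisymm h1.2 (hφ ▸ hm ht h0 ht.2)

/-- Strictly increasing times at which a reparameterized polygonal curve visits its vertices. -/
lemma IsReparamTo.exists_vertex_times {d n : ℕ} (hn : 1 ≤ n)
    {p : Fin (n + 1) → EuclideanSpace ℝ (Fin d)}
    (hp : ∀ i < n, pext p i ≠ pext p (i + 1)) {φ : ℝ → ℝ} (h : IsReparamTo (cum p n) φ) :
    ∃ τ : ℕ → ℝ, τ 0 = 0 ∧ τ n = 1 ∧ (∀ i ≤ n, τ i ∈ Icc (0 : ℝ) 1 ∧ φ (τ i) = cum p i) ∧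
      ∀ i < n, τ i < τ (i + 1) := by
  have hL : 0 ≤ cum p n := cum_zero p ▸ monotone_cum p (Nat.zero_le n)
  have hex : ∀ i, ∃ t ∈ Icc (0 : ℝ) 1, i ≤ n → φ t = cum p i ∧ (i = 0 → t = 0) ∧
      (i = n → t = 1) := by
    intro i
    rcases Nat.eq_zero_or_pos i with rfl | hi
    · exact ⟨0, by simp, fun _ => ⟨by rw [h.map_zero hL, cum_zero], fun _ => rfl, by omega⟩⟩
    by_cases hin : i = n
    · subst hin
      exact ⟨1, by simp, fun _ => ⟨h.map_one hL, by omega, fun _ => rfl⟩⟩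
    by_cases hle : i ≤ n
    · obtain ⟨t, ht, he⟩ : cum p i ∈ φ '' Icc 0 1 :=
        h.2.2 ▸ ⟨cum_zero p ▸ monotone_cum p (Nat.zero_le i), monotone_cum p hle⟩
      exact ⟨t, ht, fun _ => ⟨he, by omega, by omega⟩⟩
    · exact ⟨0, by simp, by omega⟩
  choose τ hτ hτ' using hex
  refine ⟨τ, (hτ' 0 (Nat.zero_le n)).2.1 rfl, (hτ' n le_rfl).2.2 rfl,
    fun i hi => ⟨hτ i, (hτ' i hi).1⟩, fun i hi => ?_⟩
  by_contra! hle
  have h1 := h.2.1 (hτ _) (hτ _) hle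
  rw [(hτ' i hi.le).1, (hτ' (i + 1) hi).1] at h1
  exact absurd h1 (not_le.2 (cum_lt_cum_succ hi (hp i hi)))

/-! ### Portals and paths in the VE graph -/

lemma isVPortal_swap {d n m : ℕ} {p : Fin (n + 1) → EuclideanSpace ℝ (Fin d)}
    {q : Fin (m + 1) → EuclideanSpace ℝ (Fin d)} {A B : ℝ → EuclideanSpace ℝ (Fin d)}
    {i j : ℕ} {z : ℝ × ℝ} : IsVPortal q p B A j i z.swap ↔ IsHPortal p q A B i j z := by
  obtain ⟨a, b⟩ := z
  simp only [IsVPortal, IsHPortal, Prod.swap_prod_mk, Prod.mk.injEq, dist_comm (B _)]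
  tauto

lemma exists_isVPortal_le {d n m : ℕ} {p : Fin (n + 1) → EuclideanSpace ℝ (Fin d)}
    {q : Fin (m + 1) → EuclideanSpace ℝ (Fin d)} {A B : ℝ → EuclideanSpace ℝ (Fin d)}
    (hB : IsArcParam q B) {i j : ℕ} (hj : j < m) {r y : ℝ}
    (hy : y ∈ Icc (cum q j) (cum q (j + 1))) (hr : dist (A (cum p (i + 1))) (B y) ≤ r)
    (ht : dist (A (cum p n)) (B (cum q m)) ≤ r) :
    ∃ v, IsVPortal p q A B (i + 1) j v ∧ dist (A v.1) (B v.2) ≤ r := by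
  by_cases hc : i + 1 = n ∧ j = m - 1
  · exact ⟨(cum p n, cum q m), Or.inr (Or.inl ⟨hc.1, hc.2, rfl⟩), ht⟩
  have hcont : ContinuousOn (fun y => dist (A (cum p (i + 1))) (B y))
      (Icc (cum q j) (cum q (j + 1))) :=
    (continuous_const.dist continuous_id).comp_continuousOn (hB.continuousOn hj)
  obtain ⟨y₀, hy₀, hmin⟩ := isCompact_Icc.exists_isMinOn ⟨y, hy⟩ hcont
  exact ⟨(cum p (i + 1), y₀), Or.inr (Or.inr ⟨by omega, hc, rfl, hy₀, fun w hw => hmin hw⟩),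
    (hmin hy).trans hr⟩

lemma exists_isHPortal_le {d n m : ℕ} {p : Fin (n + 1) → EuclideanSpace ℝ (Fin d)}
    {q : Fin (m + 1) → EuclideanSpace ℝ (Fin d)} {A B : ℝ → EuclideanSpace ℝ (Fin d)}
    (hA : IsArcParam p A) {i j : ℕ} (hi : i < n) {r x : ℝ}
    (hx : x ∈ Icc (cum p i) (cum p (i + 1))) (hr : dist (A x) (B (cum q (j + 1))) ≤ r)
    (ht : dist (A (cum p n)) (B (cum q m)) ≤ r) :
    ∃ v, IsHPortal p q A B i (j + 1) v ∧ dist (A v.1) (B v.2) ≤ r := by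
  rw [dist_comm] at hr ht
  obtain ⟨v, hv, hvr⟩ := exists_isVPortal_le hA hi hx hr ht
  exact ⟨v.swap, isVPortal_swap.1 (by simpa using hv), by simpa [dist_comm] using hvr⟩

/-- From a left or bottom portal of a cell visited by a reparameterization of elevation at most
`r`, the VE graph has a path to the final corner through vertices of elevation at most `r`. -/
lemma exists_chain_of_times {d n m : ℕ} {p : Fin (n + 1) → EuclideanSpace ℝ (Fin d)}
    {q : Fin (m + 1) → EuclideanSpace ℝ (Fin d)} {A B : ℝ → EuclideanSpace ℝ (Fin d)}
    (hA : IsArcParam p A) (hB : IsArcParam q B) {φ ψ : ℝ → ℝ}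
    (hφ : MonotoneOn φ (Icc 0 1)) (hψ : MonotoneOn ψ (Icc 0 1)) {r : ℝ}
    (hr : ∀ t ∈ Icc (0 : ℝ) 1, dist (A (φ t)) (B (ψ t)) ≤ r)
    {τ σ : ℕ → ℝ} (hτn : τ n = 1) (hσm : σ m = 1)
    (hτ : ∀ i ≤ n, τ i ∈ Icc (0 : ℝ) 1 ∧ φ (τ i) = cum p i)
    (hσ : ∀ j ≤ m, σ j ∈ Icc (0 : ℝ) 1 ∧ ψ (σ j) = cum q j)
    (hτlt : ∀ i < n, τ i < τ (i + 1)) (hσlt : ∀ j < m, σ j < σ (j + 1))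
    {i j : ℕ} (hi : i < n) (hj : j < m) (hij : τ i ≤ σ (j + 1)) (hji : σ j ≤ τ (i + 1))
    {u : ℝ × ℝ} (hu : IsVPortal p q A B i j u ∨ IsHPortal p q A B i j u)
    (hur : dist (A u.1) (B u.2) ≤ r) :
    ∃ l : List (ℝ × ℝ), (u :: l).getLast? = some (cum p n, cum q m) ∧
      (u :: l).IsChain (VEEdge p q A B) ∧ ∀ z ∈ u :: l, dist (A z.1) (B z.2) ≤ r := by
  have ht : dist (A (cum p n)) (B (cum q m)) ≤ r := by
    have h1 := hr 1 (by simp)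
    rwa [← hτn, (hτ n le_rfl).2, hτn, ← hσm, (hσ m le_rfl).2] at h1
  by_cases hlast : i + 1 = n ∧ j + 1 = m
  · refine ⟨[(cum p n, cum q m)], by simp, ?_, by simp [hur, ht]⟩
    refine List.isChain_pair.2 ⟨i, hi, j, hj, hu, Or.inl (Or.inr (Or.inl ⟨hlast.1, ?_, rfl⟩))⟩
    omega
  -- it suffices to move to a portal shared with a later visited cell
  have extend : ∀ v, VEEdge p q A B u v → (∃ l : List (ℝ × ℝ),
      (v :: l).getLast? = some (cum p n, cum q m) ∧ (v :: l).IsChain (VEEdge p q A B) ∧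
      ∀ z ∈ v :: l, dist (A z.1) (B z.2) ≤ r) → ∃ l : List (ℝ × ℝ),
      (u :: l).getLast? = some (cum p n, cum q m) ∧ (u :: l).IsChain (VEEdge p q A B) ∧
      ∀ z ∈ u :: l, dist (A z.1) (B z.2) ≤ r := by
    rintro v huv ⟨l, hl, hc, hle⟩
    exact ⟨v :: l, by simpa using hl, List.isChain_cons_cons.2 ⟨huv, hc⟩,
      List.forall_mem_cons.2 ⟨hur, hle⟩⟩
  rcases le_total (τ (i + 1)) (σ (j + 1)) with hle | hle
  · have hi' : i + 1 < n := by
      by_contra hcon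
      obtain rfl : i + 1 = n := by omega
      have hj' : j + 1 < m := by omega
      linarith [hσlt _ hj', (hσ (j + 2) hj').1.2]
    have hy : ψ (τ (i + 1)) ∈ Icc (cum q j) (cum q (j + 1)) := by
      rw [← (hσ j hj.le).2, ← (hσ (j + 1) hj).2]
      exact ⟨hψ (hσ j hj.le).1 (hτ (i + 1) hi).1 hji,
        hψ (hτ (i + 1) hi).1 (hσ (j + 1) hj).1 hle⟩
    have h1 := hr _ (hτ (i + 1) hi).1
    rw [(hτ (i + 1) hi).2] at h1
    obtain ⟨v, hv, hvr⟩ := exists_isVPortal_le hB hj hy h1 ht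
    exact extend v ⟨i, hi, j, hj, hu, Or.inl hv⟩
      (exists_chain_of_times hA hB hφ hψ hr hτn hσm hτ hσ hτlt hσlt hi' hj hle
        (hji.trans (hτlt _ hi').le) (Or.inl hv) hvr)
  · have hj' : j + 1 < m := by
      by_contra hcon
      obtain rfl : j + 1 = m := by omega
      have hi' : i + 1 < n := by omega
      linarith [hτlt _ hi', (hτ (i + 2) hi').1.2]
    have hx : φ (σ (j + 1)) ∈ Icc (cum p i) (cum p (i + 1)) := by
      rw [← (hτ i hi.le).2, ← (hτ (i + 1) hi).2]
      exact ⟨hφ (hτ i hi.le).1 (hσ (j + 1) hj).1 hij,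
        hφ (hσ (j + 1) hj).1 (hτ (i + 1) hi).1 hle⟩
    have h1 := hr _ (hσ (j + 1) hj).1
    rw [(hσ (j + 1) hj).2] at h1
    obtain ⟨v, hv, hvr⟩ := exists_isHPortal_le hA hi hx h1 ht
    exact extend v ⟨i, hi, j, hj, hu, Or.inr hv⟩
      (exists_chain_of_times hA hB hφ hψ hr hτn hσm hτ hσ hτlt hσlt hi hj'
        (hij.trans (hσlt _ hj').le) hle (Or.inr hv) hvr)
termination_by (n - i) + (m - j)

lemma pathWidth_nonneg {d : ℕ} (A B : ℝ → EuclideanSpace ℝ (Fin d)) (l : List (ℝ × ℝ)) :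
    0 ≤ pathWidth A B l := by
  refine Real.sSup_nonneg ?_
  rintro _ ⟨z, _, rfl⟩
  exact dist_nonneg

lemma IsVEPath.dVE_le {d n m : ℕ} {p : Fin (n + 1) → EuclideanSpace ℝ (Fin d)}
    {q : Fin (m + 1) → EuclideanSpace ℝ (Fin d)} {A B : ℝ → EuclideanSpace ℝ (Fin d)}
    {l : List (ℝ × ℝ)} (hl : IsVEPath p q A B l) {r : ℝ}
    (hr : ∀ z ∈ l, dist (A z.1) (B z.2) ≤ r) : dVE p q A B ≤ r := by
  have hbdd : BddBelow { r | ∃ l, IsVEPath p q A B l ∧ r = pathWidth A B l } := by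
    refine ⟨0, ?_⟩
    rintro _ ⟨l, _, rfl⟩
    exact pathWidth_nonneg A B l
  refine (csInf_le hbdd ⟨l, hl, rfl⟩).trans (csSup_le ?_ ?_)
  · exact ⟨_, mem_image_of_mem _ (List.mem_of_mem_head? (by rw [hl.1]; rfl))⟩
  · rintro _ ⟨z, hz, rfl⟩
    exact hr z hz

/-- The VE Fréchet distance is a lower bound on the (monotone,
continuous) Fréchet distance. -/
theorem dVE_le_frechet (d n m : ℕ) (hn : 1 ≤ n) (hm : 1 ≤ m)
    (p : Fin (n + 1) → EuclideanSpace ℝ (Fin d))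
    (q : Fin (m + 1) → EuclideanSpace ℝ (Fin d))
    (hp : ∀ i < n, pext p i ≠ pext p (i + 1))
    (hq : ∀ j < m, pext q j ≠ pext q (j + 1))
    (A B : ℝ → EuclideanSpace ℝ (Fin d))
    (hA : IsArcParam p A) (hB : IsArcParam q B) :
    dVE p q A B ≤ frechetDistL (cum p n) (cum q m) A B := by
  have hLp : 0 ≤ cum p n := cum_zero p ▸ monotone_cum p (Nat.zero_le n)
  have hLq : 0 ≤ cum q m := cum_zero q ▸ monotone_cum q (Nat.zero_le m)
  refine le_csInf ⟨_, _, _, isReparamTo_mul hLp, isReparamTo_mul hLq, rfl⟩ ?_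
  rintro _ ⟨φ, ψ, hφ, hψ, rfl⟩
  have hbdd : BddAbove ((fun t => dist (A (φ t)) (B (ψ t))) '' Icc (0 : ℝ) 1) := by
    obtain ⟨C, hC⟩ := Metric.isBounded_iff.1
      ((hA.isBounded_image hn).union (hB.isBounded_image hm))
    refine ⟨C, ?_⟩
    rintro _ ⟨t, ht, rfl⟩
    exact hC (Or.inl (mem_image_of_mem A (hφ.2.2 ▸ mem_image_of_mem φ ht)))
      (Or.inr (mem_image_of_mem B (hψ.2.2 ▸ mem_image_of_mem ψ ht)))
  have hr : ∀ t ∈ Icc (0 : ℝ) 1, dist (A (φ t)) (B (ψ t)) ≤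
      sSup ((fun t => dist (A (φ t)) (B (ψ t))) '' Icc (0 : ℝ) 1) :=
    fun t ht => le_csSup hbdd ⟨t, ht, rfl⟩
  obtain ⟨τ, hτ0, hτn, hτ, hτlt⟩ := hφ.exists_vertex_times hn hp
  obtain ⟨σ, hσ0, hσm, hσ, hσlt⟩ := hψ.exists_vertex_times hm hq
  have h0 := hr 0 (by simp)
  rw [hφ.map_zero hLp, hψ.map_zero hLq] at h0
  obtain ⟨l, hlast, hchain, hle⟩ := exists_chain_of_times hA hB hφ.2.1 hψ.2.1 hr hτn hσm hτ hσ
    hτlt hσlt (i := 0) (j := 0) (u := (0, 0)) hn hm (hτ0 ▸ (hσ 1 hm).1.1)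
    (hσ0 ▸ (hτ 1 hn).1.1) (Or.inl (Or.inl ⟨rfl, rfl, rfl⟩)) h0
  exact IsVEPath.dVE_le ⟨rfl, hlast, hchain⟩ hle
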